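/- Exponential transformation of the Schrödinger equation (forward direction): Let ħ > 0, m > 0, let V : ℝⁿ → ℝ be continuous, let ψ : ℝⁿ × ℝ → ℂ be nowhere vanishing, twice continuously differentiable in x and once in t, and satisfy the Schrödinger equation ∂ψ/∂t = (iħ/(2m))Δψ − (i/ħ)V(x)ψ at every (x,t). Define the quantum drift field v_q := (ħ/(i·m))·(∇ψ/ψ). Let φ : ℝⁿ × ℝ → ℂ be twice continuously differentiable in x and once in t and satisfy ∂φ/∂t + v_q·∇φ − (iħ/(2m))Δφ = (iħ/(2m))·∇φ·∇φ at every (x,t). Then ψ̃ := exp(φ)·ψ satisfies the Schrödinger equation ∂ψ̃/∂t = (iħ/(2m))Δψ̃ − (i/ħ)V(x)ψ̃ at every (x,t). -/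

import Mathlib

open Complex

/-- Spatial partial derivative in direction `i` of a `ℂ`-valued function `f(x,t)`. -/
noncomputable def pd {n : ℕ} (i : Fin n) (f : (Fin n → ℝ) → ℝ → ℂ) :
    (Fin n → ℝ) → ℝ → ℂ :=
  fun x t => fderiv ℝ (fun y => f y t) x (Pi.single i 1)

theorem pd_mul {n : ℕ} (i : Fin n) {f g : (Fin n → ℝ) → ℝ → ℂ} {x : Fin n → ℝ} {t : ℝ}
    (hf : DifferentiableAt ℝ (fun y => f y t) x) (hg : DifferentiableAt ℝ (fun y => g y t) x) :
    pd i (fun y s => f y s * g y s) x t = f x t * pd i g x t + pd i f x t * g x t := by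
  simp only [pd]
  rw [fderiv_fun_mul hf hg]
  simp [mul_comm]

theorem pd_add {n : ℕ} (i : Fin n) {f g : (Fin n → ℝ) → ℝ → ℂ} {x : Fin n → ℝ} {t : ℝ}
    (hf : DifferentiableAt ℝ (fun y => f y t) x) (hg : DifferentiableAt ℝ (fun y => g y t) x) :
    pd i (fun y s => f y s + g y s) x t = pd i f x t + pd i g x t := by
  simp only [pd]
  rw [fderiv_fun_add hf hg]
  simp

theorem pd_cexp {n : ℕ} (i : Fin n) {f : (Fin n → ℝ) → ℝ → ℂ} {x : Fin n → ℝ} {t : ℝ}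
    (hf : DifferentiableAt ℝ (fun y => f y t) x) :
    pd i (fun y s => Complex.exp (f y s)) x t = Complex.exp (f x t) * pd i f x t := by
  simp only [pd]
  rw [hf.hasFDerivAt.cexp.fderiv]
  simp

/-- The value of `pd i f` at time `t` depends only on the slice of `f` at time `t`. -/
theorem pd_congr_slice {n : ℕ} (i : Fin n) {f g : (Fin n → ℝ) → ℝ → ℂ} {t : ℝ}
    (h : ∀ y, f y t = g y t) (x : Fin n → ℝ) : pd i f x t = pd i g x t := by
  simp only [pd, h]

theorem differentiable_pd {n : ℕ} (i : Fin n) {f : (Fin n → ℝ) → ℝ → ℂ} {t : ℝ}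
    (hf : ContDiff ℝ 2 (fun y => f y t)) : Differentiable ℝ (fun y => pd i f y t) :=
  ((hf.fderiv_right (m := 1) (by norm_num)).clm_apply contDiff_const).differentiable
    (by norm_num)

theorem pd_pd_cexp_mul {n : ℕ} (i : Fin n) {φ ψ : (Fin n → ℝ) → ℝ → ℂ} {t : ℝ}
    (hφ : ContDiff ℝ 2 (fun y => φ y t)) (hψ : ContDiff ℝ 2 (fun y => ψ y t))
    (x : Fin n → ℝ) :
    pd i (pd i fun y s => Complex.exp (φ y s) * ψ y s) x t
      = Complex.exp (φ x t) * (pd i (pd i ψ) x t + 2 * (pd i ψ x t * pd i φ x t)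
          + ψ x t * (pd i (pd i φ) x t + pd i φ x t ^ 2)) := by
  have dφ : Differentiable ℝ (fun y => φ y t) := hφ.differentiable (by norm_num)
  have dψ : Differentiable ℝ (fun y => ψ y t) := hψ.differentiable (by norm_num)
  have dφ' := differentiable_pd i hφ
  have dψ' := differentiable_pd i hψ
  have de : Differentiable ℝ (fun y => Complex.exp (φ y t)) := dφ.cexp
  have hfirst : ∀ y, pd i (fun y s => Complex.exp (φ y s) * ψ y s) y t
      = Complex.exp (φ y t) * (pd i ψ y t + pd i φ y t * ψ y t) := fun y => by
    rw [pd_mul i (f := fun y s => Complex.exp (φ y s)) (de y) (dψ y), pd_cexp i (dφ y)]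
    ring
  rw [pd_congr_slice i
      (g := fun y s => Complex.exp (φ y s) * (pd i ψ y s + pd i φ y s * ψ y s)) hfirst x,
    pd_mul i (f := fun y s => Complex.exp (φ y s))
      (g := fun y s => pd i ψ y s + pd i φ y s * ψ y s)
      (de x) ((dψ' x).add ((dφ' x).mul (dψ x))),
    pd_cexp i (dφ x),
    pd_add i (g := fun y s => pd i φ y s * ψ y s) (dψ' x) ((dφ' x).mul (dψ x)),
    pd_mul i (dφ' x) (dψ x)]
  ring

/-- Exponential transformation of the Schrödinger equation (forward direction): if the
nowhere-vanishing `ψ` satisfies the Schrödinger equation, the quantum drift field is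
`v_q = (ħ/(im))∇ψ/ψ`, and `φ` satisfies
`∂φ/∂t + v_q·∇φ − (iħ/(2m))Δφ = (iħ/(2m))∇φ·∇φ`, then `ψ̃ = exp(φ)·ψ` also satisfies
the Schrödinger equation `∂ψ̃/∂t = (iħ/(2m))Δψ̃ − (i/ħ)Vψ̃`. -/
theorem schrodinger_exp_transform {n : ℕ} (hbar m : ℝ)
    (hhbar : 0 < hbar) (hm : 0 < m)
    (V : (Fin n → ℝ) → ℝ) (hV : Continuous V)
    (ψ : (Fin n → ℝ) → ℝ → ℂ)
    (hψ0 : ∀ x t, ψ x t ≠ 0)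
    (hψx : ∀ t, ContDiff ℝ 2 (fun x => ψ x t))
    (hψt : ∀ x, ContDiff ℝ 1 (fun t => ψ x t))
    (hSE : ∀ x t, deriv (fun s => ψ x s) t
        = (I * (hbar : ℂ) / (2 * (m : ℂ))) * ∑ i, pd i (pd i ψ) x t
          - (I / (hbar : ℂ)) * (V x : ℂ) * ψ x t)
    (φ : (Fin n → ℝ) → ℝ → ℂ)
    (hφx : ∀ t, ContDiff ℝ 2 (fun x => φ x t))
    (hφt : ∀ x, ContDiff ℝ 1 (fun t => φ x t))
    (hφPDE : ∀ x t, deriv (fun s => φ x s) t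
        + ∑ i, ((hbar : ℂ) / (I * (m : ℂ))) * (pd i ψ x t / ψ x t) * pd i φ x t
        - (I * (hbar : ℂ) / (2 * (m : ℂ))) * ∑ i, pd i (pd i φ) x t
        = (I * (hbar : ℂ) / (2 * (m : ℂ))) * ∑ i, (pd i φ x t) ^ 2) :
    ∀ x t, deriv (fun s => Complex.exp (φ x s) * ψ x s) t
        = (I * (hbar : ℂ) / (2 * (m : ℂ)))
            * ∑ i, pd i (pd i fun y s => Complex.exp (φ y s) * ψ y s) x t
          - (I / (hbar : ℂ)) * (V x : ℂ) * (Complex.exp (φ x t) * ψ x t) := by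
  intro x t
  have hφd : HasDerivAt (fun s => φ x s) (deriv (fun s => φ x s) t) t :=
    ((hφt x).differentiable (by norm_num) t).hasDerivAt
  have hψd : HasDerivAt (fun s => ψ x s) (deriv (fun s => ψ x s) t) t :=
    ((hψt x).differentiable (by norm_num) t).hasDerivAt
  rw [(hφd.cexp.fun_mul hψd).deriv]
  simp only [pd_pd_cexp_mul _ (hφx t) (hψx t), ← Finset.mul_sum, Finset.sum_add_distrib]
  have hm0 : (m : ℂ) ≠ 0 := by exact_mod_cast hm.ne'
  have hdrift : ψ x t *
      ∑ i, ((hbar : ℂ) / (I * (m : ℂ))) * (pd i ψ x t / ψ x t) * pd i φ x t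
        = -(2 * (I * (hbar : ℂ) / (2 * (m : ℂ)))) * ∑ i, pd i ψ x t * pd i φ x t := by
    rw [Finset.mul_sum, Finset.mul_sum]
    refine Finset.sum_congr rfl fun i _ => ?_
    have := hψ0 x t
    field_simp
    rw [I_sq]
    ring
  linear_combination Complex.exp (φ x t) * (hSE x t + ψ x t * hφPDE x t - hdrift)
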